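/- Let R be a commutative ring, n ≥ 1, a₂, …, a_n ∈ R, and define λ_{ij} = 1 if i ≤ j and λ_{ij} = a_{j+1}·a_{j+2}⋯a_i if i > j (1 ≤ i, j ≤ n). Let h_{ij} ∈ R (1 ≤ i, j ≤ n) and define the n×n matrices A and B by A_{ij} = λ_{ij}·h_{ij} and B_{ij} = λ_{ji}·h_{ij}. Then det(A) = det(B). -/

import Mathlib

theorem card_cross {n : ℕ} (σ : Equiv.Perm (Fin n)) (P : Fin n → Prop) [DecidablePred P] :
    (Finset.univ.filter (fun i => P i ∧ ¬ P (σ i))).card =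
    (Finset.univ.filter (fun i => P (σ i) ∧ ¬ P i)).card := by
  have e : (Finset.univ.filter (fun i => P (σ i))).card = (Finset.univ.filter P).card := by
    simp only [Finset.card_filter]
    exact Equiv.sum_comp σ (fun i => if P i then 1 else 0)
  have h1 := Finset.card_filter_add_card_filter_not (s := Finset.univ.filter P) (fun i => P (σ i))
  have h2 := Finset.card_filter_add_card_filter_not
    (s := Finset.univ.filter (fun i => P (σ i))) P
  simp only [Finset.filter_filter] at h1 h2
  have h3 : (Finset.univ.filter (fun i => P i ∧ P (σ i))) =
    (Finset.univ.filter (fun i => P (σ i) ∧ P i)) := by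
    ext i; simp [and_comm]
  rw [h3] at h1
  omega

theorem det_eq_det
    {R : Type*} [CommRing R] (n : ℕ) (hn : 1 ≤ n) (a : ℕ → R)
    (lam : Fin n → Fin n → R)
    (hlam : ∀ i j : Fin n, lam i j =
      if (i : ℕ) ≤ (j : ℕ) then 1
      else ∏ l ∈ Finset.Icc ((j : ℕ) + 2) ((i : ℕ) + 1), a l)
    (h : Fin n → Fin n → R)
    (A B : Matrix (Fin n) (Fin n) R)
    (hA : ∀ i j : Fin n, A i j = lam i j * h i j)
    (hB : ∀ i j : Fin n, B i j = lam j i * h i j) :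
    A.det = B.det := by
  have hl : ∀ i j : Fin n, lam i j = ∏ l ∈ Finset.range (n + 2),
      if (j : ℕ) + 2 ≤ l ∧ ¬ ((i : ℕ) + 2 ≤ l) then a l else 1 := by
    intro i j
    rw [hlam, ← Finset.prod_filter]
    have : (Finset.range (n + 2)).filter (fun l => (j : ℕ) + 2 ≤ l ∧ ¬ ((i : ℕ) + 2 ≤ l))
        = Finset.Icc ((j : ℕ) + 2) ((i : ℕ) + 1) := by
      ext l
      simp only [Finset.mem_filter, Finset.mem_range, Finset.mem_Icc]
      have := i.2
      omega
    rw [this]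
    split_ifs with hij
    · rw [Finset.Icc_eq_empty (by omega), Finset.prod_empty]
    · rfl
  rw [Matrix.det_apply, Matrix.det_apply]
  refine Finset.sum_congr rfl fun σ _ => ?_
  congr 1
  simp only [hA, hB, Finset.prod_mul_distrib]
  congr 1
  simp only [hl]
  rw [Finset.prod_comm]
  conv_rhs => rw [Finset.prod_comm]
  refine Finset.prod_congr rfl fun l _ => ?_
  rw [← Finset.prod_filter, ← Finset.prod_filter, Finset.prod_const, Finset.prod_const]
  rw [card_cross σ (fun i => (i : ℕ) + 2 ≤ l)]
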